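/- For every M > 0 there exist a constant ζ with e^{-M} < ζ < e^{-M/2} and a C^∞ function b : ℝ → ℝ such that: b is nonincreasing on [0,∞); b(x) = e^{-x} for 0 ≤ x ≤ M/2; b(x) = ζ for x ≥ M; b(x) ≥ e^{-x} for all x ≥ 0; and for every n ∈ ℕ there is a constant C_n > 0 with |b^{(n)}(x)| ≤ C_n b(x) for all x ≥ 0, where b^{(n)} denotes the n-th derivative of b. -/

import Mathlib

theorem exists_modified_exponential_cutoff :
    ∀ M : ℝ, 0 < M →
      ∃ ζ : ℝ, Real.exp (-M) < ζ ∧ ζ < Real.exp (-M / 2) ∧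
        ∃ b : ℝ → ℝ,
          ContDiff ℝ (⊤ : ℕ∞) b ∧
          AntitoneOn b (Set.Ici (0 : ℝ)) ∧
          (∀ x ∈ Set.Icc (0 : ℝ) (M / 2), b x = Real.exp (-x)) ∧
          (∀ x : ℝ, M ≤ x → b x = ζ) ∧
          (∀ x : ℝ, 0 ≤ x → Real.exp (-x) ≤ b x) ∧
          (∀ n : ℕ, ∃ C : ℝ, 0 < C ∧
            ∀ x : ℝ, 0 ≤ x → |iteratedDeriv n b x| ≤ C * b x) := by
  intro M hM
  obtain ⟨f, hf⟩ : ∃ f : ℝ → ℝ, f = fun x => 1 - Real.smoothTransition ((x - M / 2) / (M / 2)) :=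
    ⟨_, rfl⟩
  have hM2 : 0 < M / 2 := by positivity
  have fsm : ContDiff ℝ (⊤ : ℕ∞) f := by
    rw [hf]
    exact contDiff_const.sub (Real.smoothTransition.contDiff.comp
      ((contDiff_id.sub contDiff_const).div_const _))
  have fc : Continuous f := fsm.continuous
  have f0 : ∀ x, 0 ≤ f x := fun x => by
    rw [hf]; exact sub_nonneg.2 (Real.smoothTransition.le_one _)
  have f1 : ∀ x, f x ≤ 1 := fun x => by
    rw [hf]; exact sub_le_self _ (Real.smoothTransition.nonneg _)
  have fpos : ∀ x, x < M → 0 < f x := fun x hx => by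
    rw [hf]; refine sub_pos.2 (Real.smoothTransition.lt_one_of_lt_one ?_)
    rw [div_lt_one hM2]; linarith
  have flt : ∀ x, M / 2 < x → f x < 1 := fun x hx => by
    rw [hf]; refine sub_lt_self _ (Real.smoothTransition.pos_of_pos ?_)
    exact div_pos (by linarith) hM2
  have feq1 : ∀ x, x ≤ M / 2 → f x = 1 := fun x hx => by
    have : Real.smoothTransition ((x - M / 2) / (M / 2)) = 0 :=
      Real.smoothTransition.zero_of_nonpos
        (div_nonpos_of_nonpos_of_nonneg (by linarith) hM2.le)
    simp [hf, this]
  have feq0 : ∀ x, M ≤ x → f x = 0 := fun x hx => by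
    have : Real.smoothTransition ((x - M / 2) / (M / 2)) = 1 := by
      refine Real.smoothTransition.one_of_one_le ?_
      rw [one_le_div hM2]; linarith
    simp [hf, this]
  obtain ⟨G, hG⟩ : ∃ G : ℝ → ℝ, G = fun x => ∫ t in (0 : ℝ)..x, f t := ⟨_, rfl⟩
  have Gd : ∀ x, HasDerivAt G (f x) x := fun x => by
    rw [hG]; exact fc.integral_hasStrictDerivAt 0 x |>.hasDerivAt
  have Gdiff : Differentiable ℝ G := fun x => (Gd x).differentiableAt
  have Gderiv : deriv G = f := funext fun x => (Gd x).deriv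
  have Gsm : ContDiff ℝ (⊤ : ℕ∞) G := by
    rw [contDiff_infty_iff_deriv, Gderiv]; exact ⟨Gdiff, fsm⟩
  have Gmono : Monotone G := monotone_of_deriv_nonneg Gdiff (by rw [Gderiv]; exact f0)
  have Hd : ∀ x, HasDerivAt (fun y => y - G y) (1 - f x) x := fun x =>
    (hasDerivAt_id x).sub (Gd x)
  have Hdiff : Differentiable ℝ (fun y => y - G y) := fun x => (Hd x).differentiableAt
  have Hmono : Monotone (fun y => y - G y) := monotone_of_deriv_nonneg Hdiff
    (fun x => by rw [(Hd x).deriv]; linarith [f1 x])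
  have G0 : G 0 = 0 := by simp [hG]
  have Gid : ∀ x ∈ Set.Icc (0 : ℝ) (M / 2), G x = x := by
    intro x hx
    have : (∫ t in (0 : ℝ)..x, f t) = ∫ t in (0 : ℝ)..x, (1 : ℝ) := by
      apply intervalIntegral.integral_congr
      intro t ht
      rw [Set.uIcc_of_le hx.1] at ht
      exact feq1 t (ht.2.trans hx.2)
    simp [hG, this]
  have Gconst : ∀ x, M ≤ x → G x = G M := by
    intro x hx
    have h := intervalIntegral.integral_add_adjacent_intervals
      (fc.intervalIntegrable (μ := MeasureTheory.volume) 0 M) (fc.intervalIntegrable M x)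
    have : (∫ t in M..x, f t) = ∫ t in M..x, (0 : ℝ) := by
      apply intervalIntegral.integral_congr
      intro t ht
      rw [Set.uIcc_of_le hx] at ht
      exact feq0 t ht.1
    rw [this] at h
    simp only [intervalIntegral.integral_zero, add_zero] at h
    rw [hG]; exact h.symm
  have Gh : G (M / 2) = M / 2 := Gid _ ⟨hM2.le, le_rfl⟩
  have hlt : M / 2 < M := by linarith
  have Glow : M / 2 < G M := by
    have := strictMonoOn_of_deriv_pos (convex_Icc (M / 2) M) Gdiff.continuous.continuousOn
      (fun x hx => by
        rw [interior_Icc] at hx; rw [Gderiv]; exact fpos x hx.2)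
      ⟨le_rfl, hlt.le⟩ ⟨hlt.le, le_rfl⟩ hlt
    rwa [Gh] at this
  have Gup : G M < M := by
    have := strictMonoOn_of_deriv_pos (convex_Icc (M / 2) M) Hdiff.continuous.continuousOn
      (fun x hx => by
        rw [interior_Icc] at hx; rw [(Hd x).deriv]; linarith [flt x hx.1])
      ⟨le_rfl, hlt.le⟩ ⟨hlt.le, le_rfl⟩ hlt
    simp only [Gh] at this
    linarith
  have bsm : ContDiff ℝ (⊤ : ℕ∞) (fun x => Real.exp (-G x)) := Real.contDiff_exp.comp Gsm.neg
  have bconst : ∀ x, M ≤ x → Real.exp (-G x) = Real.exp (-G M) := fun x hx => by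
    rw [Gconst x hx]
  have blow : ∀ x, Real.exp (-G M) ≤ Real.exp (-G x) := fun x => by
    rcases le_total M x with h | h
    · exact (bconst x h).ge
    · exact Real.exp_le_exp.2 (neg_le_neg (Gmono h))
  refine ⟨Real.exp (-G M), Real.exp_lt_exp.2 (by linarith), Real.exp_lt_exp.2 (by linarith),
    fun x => Real.exp (-G x), bsm, ?_, ?_, bconst, ?_, ?_⟩
  · intro x _ y _ hxy
    exact Real.exp_le_exp.2 (neg_le_neg (Gmono hxy))
  · intro x hx
    simp only [Gid x hx]
  · intro x hx
    have := Hmono hx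
    simp only [G0] at this
    exact Real.exp_le_exp.2 (by linarith)
  · intro n
    have hcont : Continuous (iteratedDeriv n (fun x => Real.exp (-G x))) :=
      bsm.continuous_iteratedDeriv n (by exact_mod_cast le_top)
    obtain ⟨K, hK⟩ := (isCompact_Icc (a := (0 : ℝ)) (b := M)).exists_bound_of_continuousOn
      hcont.continuousOn
    have hK0 : 0 ≤ K := (norm_nonneg _).trans (hK 0 ⟨le_rfl, hM.le⟩)
    have hz : 0 < Real.exp (-G M) := Real.exp_pos _
    have hbd : ∀ x, 0 ≤ x →
        |iteratedDeriv n (fun x => Real.exp (-G x)) x| ≤ K + Real.exp (-G M) := by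
      intro x hx
      rcases le_or_gt x M with h | h
      · have := hK x ⟨hx, h⟩
        rw [Real.norm_eq_abs] at this
        linarith
      · have he : (fun x => Real.exp (-G x)) =ᶠ[nhds x] fun _ => Real.exp (-G M) := by
          filter_upwards [lt_mem_nhds h] with y hy
          exact bconst y hy.le
        rw [he.iteratedDeriv_eq n, iteratedDeriv_const]
        split_ifs
        · rw [abs_of_pos hz]; linarith
        · rw [abs_zero]; linarith
    refine ⟨(K + Real.exp (-G M)) / Real.exp (-G M), by positivity, fun x hx => ?_⟩
    refine (hbd x hx).trans ?_
    rw [div_mul_eq_mul_div, le_div_iff₀ hz]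
    exact mul_le_mul_of_nonneg_left (blow x) (by positivity)
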